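/- arXiv:1909.03811 — 2 statements merged into one kernel-verified Lean document; each statement's English description precedes it below -/
import Mathlib

section
/- Let V1 and V2 be finite-dimensional complex vector spaces, and let X1 ⊆ V1 and X2 ⊆ V2 be nonempty subsets closed under multiplication by nonzero scalars. Suppose a1, a2, a3 ∈ X1 are nonzero, pairwise non-proportional, and span a 2-dimensional subspace L1 ⊆ V1; suppose b1, b2, b3 ∈ X2 are nonzero, pairwise non-proportional, and span a 2-dimensional subspace L2 ⊆ V2; suppose φ : L1 → L2 is a linear map with φ(aj) = bj for j = 1, 2, 3; let p1 ∈ L1 be a vector with R_{X1}(p1) = 2 and set p2 = φ(p1), and assume R_{X2}(p2) = 2. Then p1 ⊗ p2 lies in the linear span of a1 ⊗ b1, a2 ⊗ b2, a3 ⊗ b3, and R_{X1 × X2}(p1 ⊗ p2) = 3. -/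
open scoped TensorProduct

noncomputable section

/-- `p` lies in the linear span of some `r` elements of `X`. -/
def HasRankLE {V : Type*} [AddCommGroup V] [Module ℂ V] (X : Set V) (p : V) (r : ℕ) : Prop :=
  ∃ v : Fin r → V, (∀ i, v i ∈ X) ∧ p ∈ Submodule.span ℂ (Set.range v)

/-- The `X`-rank of `p`. -/
def xrank {V : Type*} [AddCommGroup V] [Module ℂ V] (X : Set V) (p : V) : ℕ :=
  sInf {r | HasRankLE X p r}

/-- The Segre product of two subsets. -/
def segre {V1 V2 : Type*} [AddCommGroup V1] [Module ℂ V1] [AddCommGroup V2] [Module ℂ V2]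
    (X1 : Set V1) (X2 : Set V2) : Set (V1 ⊗[ℂ] V2) :=
  {t | ∃ x1 ∈ X1, ∃ x2 ∈ X2, t = x1 ⊗ₜ[ℂ] x2}

theorem hasRankLE_one {V : Type*} [AddCommGroup V] [Module ℂ V] {X : Set V} {x p : V}
    (hx : x ∈ X) (hp : p ∈ Submodule.span ℂ {x}) : HasRankLE X p 1 :=
  ⟨fun _ => x, fun _ => hx, by rwa [Set.range_const]⟩

theorem HasRankLE.mono {V : Type*} [AddCommGroup V] [Module ℂ V] {X : Set V} (hX : X.Nonempty)
    {p : V} {r s : ℕ} (hrs : r ≤ s) (h : HasRankLE X p r) : HasRankLE X p s := by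
  obtain ⟨v, hv, hp⟩ := h
  obtain ⟨x, hx⟩ := hX
  refine ⟨fun i => if hi : (i : ℕ) < r then v ⟨i, hi⟩ else x, fun i => ?_,
    Submodule.span_mono ?_ hp⟩
  · dsimp only
    split_ifs
    exacts [hv _, hx]
  · rintro _ ⟨i, rfl⟩
    exact ⟨Fin.castLE hrs i, by simp⟩

theorem not_hasRankLE_of_lt_xrank {V : Type*} [AddCommGroup V] [Module ℂ V] {X : Set V} {p : V}
    {r : ℕ} (h : r < xrank X p) : ¬ HasRankLE X p r :=
  Nat.notMem_of_lt_sInf h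

theorem xrank_eq_succ {V : Type*} [AddCommGroup V] [Module ℂ V] {X : Set V} (hX : X.Nonempty)
    {p : V} {r : ℕ} (h : HasRankLE X p (r + 1)) (h' : ¬ HasRankLE X p r) :
    xrank X p = r + 1 := by
  refine le_antisymm (Nat.sInf_le h) (le_csInf ⟨_, h⟩ fun s hs => ?_)
  by_contra! hlt
  exact h' (hs.mono hX (Nat.lt_succ_iff.mp hlt))

/-- If neither factor is proportional to an element of the corresponding set, then their tensor
product has Segre rank greater than two. -/
theorem not_hasRankLE_segre_two {V1 V2 : Type*} [AddCommGroup V1] [Module ℂ V1]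
    [AddCommGroup V2] [Module ℂ V2] {X1 : Set V1} {X2 : Set V2} {p1 : V1} {p2 : V2}
    (h1 : ¬ HasRankLE X1 p1 1) (h2 : ¬ HasRankLE X2 p2 1) :
    ¬ HasRankLE (segre X1 X2) (p1 ⊗ₜ[ℂ] p2) 2 := by
  rintro ⟨v, hv, hp⟩
  obtain ⟨x, hx, y, -, hxy⟩ := hv 0
  obtain ⟨x', -, y', hy', hxy'⟩ := hv 1
  obtain ⟨f, hf, hf'⟩ := Submodule.exists_le_ker_of_notMem (fun h => h2 (hasRankLE_one hy' h))
  have hfy' : f y' = 0 := hf' (Submodule.mem_span_singleton_self y')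
  rw [Submodule.mem_span_range_iff_exists_fun] at hp
  obtain ⟨c, hc⟩ := hp
  have key := congrArg ((TensorProduct.rid ℂ V1).toLinearMap ∘ₗ LinearMap.lTensor V1 f) hc
  simp only [Fin.sum_univ_two, hxy, hxy', map_add, map_smul, LinearMap.comp_apply,
    LinearMap.lTensor_tmul, LinearEquiv.coe_coe, TensorProduct.rid_tmul, hfy', zero_smul,
    smul_zero, add_zero] at key
  refine h1 (hasRankLE_one hx (Submodule.mem_span_singleton.mpr ⟨(f p2)⁻¹ * (c 0 * f y), ?_⟩))
  rw [mul_smul, mul_smul, key, inv_smul_smul₀ hf]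

/-- The tensor product of two vectors with equal coordinates in the pairs `a1, a2` and `b1, b2`
is a combination of `a1 ⊗ b1`, `a2 ⊗ b2` and any third such product with nonzero coordinates. -/
theorem tmul_mem_span_of_same_coordinates {V1 V2 : Type*} [AddCommGroup V1] [Module ℂ V1]
    [AddCommGroup V2] [Module ℂ V2] (a1 a2 : V1) (b1 b2 : V2) {s t : ℂ} (hs : s ≠ 0) (ht : t ≠ 0)
    (u v : ℂ) :
    (u • a1 + v • a2) ⊗ₜ[ℂ] (u • b1 + v • b2) ∈ Submodule.span ℂ
      ({a1 ⊗ₜ[ℂ] b1, a2 ⊗ₜ[ℂ] b2,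
        (s • a1 + t • a2) ⊗ₜ[ℂ] (s • b1 + t • b2)} : Set (V1 ⊗[ℂ] V2)) := by
  rw [Submodule.mem_span_triple]
  refine ⟨u ^ 2 - u * v * s / t, v ^ 2 - u * v * t / s, u * v / (s * t), ?_⟩
  simp only [TensorProduct.add_tmul, TensorProduct.tmul_add, ← TensorProduct.smul_tmul',
    TensorProduct.tmul_smul]
  match_scalars <;> field_simp <;> ring

theorem mem_span_pair_of_finrank_eq_two {V : Type*} [AddCommGroup V] [Module ℂ V]
    [FiniteDimensional ℂ V] {L : Submodule ℂ V} (hL : Module.finrank ℂ L = 2) {a b x : V}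
    (ha : a ∈ L) (hb : b ∈ L) (hb0 : b ≠ 0) (hab : ∀ c : ℂ, a ≠ c • b) (hx : x ∈ L) :
    ∃ u v : ℂ, u • a + v • b = x := by
  have hli : LinearIndependent ℂ ![b, a] :=
    (LinearIndependent.pair_iff' hb0).mpr fun c h => hab c h.symm
  have hle : Submodule.span ℂ (Set.range ![b, a]) ≤ L := by
    rw [Submodule.span_le]
    rintro _ ⟨i, rfl⟩
    fin_cases i
    exacts [hb, ha]
  have heq := Submodule.eq_of_le_of_finrank_eq hle (by
    rw [finrank_span_eq_card hli, hL, Fintype.card_fin])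
  rw [← heq, Matrix.range_cons_cons_empty, Set.pair_comm] at hx
  exact Submodule.mem_span_pair.mp hx

theorem stmt7 {V1 V2 : Type*}
    [AddCommGroup V1] [Module ℂ V1] [FiniteDimensional ℂ V1]
    [AddCommGroup V2] [Module ℂ V2] [FiniteDimensional ℂ V2]
    (X1 : Set V1) (X2 : Set V2) (hX1 : X1.Nonempty) (hX2 : X2.Nonempty)
    (hs1 : ∀ (c : ℂ), c ≠ 0 → ∀ x ∈ X1, c • x ∈ X1)
    (hs2 : ∀ (c : ℂ), c ≠ 0 → ∀ x ∈ X2, c • x ∈ X2)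
    (a1 a2 a3 : V1) (b1 b2 b3 : V2)
    (ha1X : a1 ∈ X1) (ha2X : a2 ∈ X1) (ha3X : a3 ∈ X1)
    (hb1X : b1 ∈ X2) (hb2X : b2 ∈ X2) (hb3X : b3 ∈ X2)
    (ha10 : a1 ≠ 0) (ha20 : a2 ≠ 0) (ha30 : a3 ≠ 0)
    (hb10 : b1 ≠ 0) (hb20 : b2 ≠ 0) (hb30 : b3 ≠ 0)
    (ha12 : ∀ c : ℂ, a1 ≠ c • a2) (ha13 : ∀ c : ℂ, a1 ≠ c • a3)
    (ha23 : ∀ c : ℂ, a2 ≠ c • a3)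
    (hb12 : ∀ c : ℂ, b1 ≠ c • b2) (hb13 : ∀ c : ℂ, b1 ≠ c • b3)
    (hb23 : ∀ c : ℂ, b2 ≠ c • b3)
    (L1 : Submodule ℂ V1) (L2 : Submodule ℂ V2)
    (hL1span : Submodule.span ℂ {a1, a2, a3} = L1)
    (hL2span : Submodule.span ℂ {b1, b2, b3} = L2)
    (hL1 : Module.finrank ℂ L1 = 2) (hL2 : Module.finrank ℂ L2 = 2)
    (ha1L : a1 ∈ L1) (ha2L : a2 ∈ L1) (ha3L : a3 ∈ L1)
    (hb1L : b1 ∈ L2) (hb2L : b2 ∈ L2) (hb3L : b3 ∈ L2)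
    (φ : L1 →ₗ[ℂ] L2)
    (hφ1 : φ ⟨a1, ha1L⟩ = ⟨b1, hb1L⟩)
    (hφ2 : φ ⟨a2, ha2L⟩ = ⟨b2, hb2L⟩)
    (hφ3 : φ ⟨a3, ha3L⟩ = ⟨b3, hb3L⟩)
    (p1 : V1) (hp1L : p1 ∈ L1) (hp1rank : xrank X1 p1 = 2)
    (p2 : V2) (hp2def : (φ ⟨p1, hp1L⟩ : V2) = p2) (hp2rank : xrank X2 p2 = 2) :
    p1 ⊗ₜ[ℂ] p2 ∈
        Submodule.span ℂ ({a1 ⊗ₜ[ℂ] b1, a2 ⊗ₜ[ℂ] b2, a3 ⊗ₜ[ℂ] b3} : Set (V1 ⊗[ℂ] V2)) ∧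
      xrank (segre X1 X2) (p1 ⊗ₜ[ℂ] p2) = 3 := by
  obtain ⟨s, t, hst⟩ := mem_span_pair_of_finrank_eq_two hL1 ha1L ha2L ha20 ha12 ha3L
  obtain ⟨u, v, huv⟩ := mem_span_pair_of_finrank_eq_two hL1 ha1L ha2L ha20 ha12 hp1L
  have hs : s ≠ 0 := by
    rintro rfl
    have ht : t ≠ 0 := by rintro rfl; simp [eq_comm, ha30] at hst
    exact ha23 t⁻¹ (by rw [← hst, zero_smul, zero_add, inv_smul_smul₀ ht])
  have ht : t ≠ 0 := by
    rintro rfl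
    exact ha13 s⁻¹ (by rw [← hst, zero_smul, add_zero, inv_smul_smul₀ hs])
  have hφ : ∀ (c d : ℂ) (x : V1) (hx : x ∈ L1), c • a1 + d • a2 = x →
      c • b1 + d • b2 = (φ ⟨x, hx⟩ : V2) := by
    rintro c d _ hx rfl
    have h : (⟨c • a1 + d • a2, hx⟩ : L1) = c • ⟨a1, ha1L⟩ + d • ⟨a2, ha2L⟩ := rfl
    rw [h, map_add, map_smul, map_smul, hφ1, hφ2]
    rfl
  have hb3 : s • b1 + t • b2 = b3 := by rw [hφ s t a3 ha3L hst, hφ3]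
  have hp2 : u • b1 + v • b2 = p2 := by rw [hφ u v p1 hp1L huv, hp2def]
  have hmem := tmul_mem_span_of_same_coordinates a1 a2 b1 b2 hs ht u v
  rw [hst, huv, hb3, hp2] at hmem
  refine ⟨hmem, xrank_eq_succ (X := segre X1 X2) ⟨a1 ⊗ₜ b1, a1, ha1X, b1, hb1X, rfl⟩
    ⟨![a1 ⊗ₜ b1, a2 ⊗ₜ b2, a3 ⊗ₜ b3], fun i => ?_, ?_⟩
    (not_hasRankLE_segre_two (not_hasRankLE_of_lt_xrank (by omega))
      (not_hasRankLE_of_lt_xrank (by omega)))⟩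
  · fin_cases i
    exacts [⟨a1, ha1X, b1, hb1X, rfl⟩, ⟨a2, ha2X, b2, hb2X, rfl⟩, ⟨a3, ha3X, b3, hb3X, rfl⟩]
  · rwa [Matrix.range_cons, Matrix.range_cons_cons_empty, Set.singleton_union]
end
end

section
/- Let V1 and V2 be finite-dimensional complex vector spaces, and let X1 ⊆ V1 and X2 ⊆ V2 be nonempty subsets closed under multiplication by nonzero scalars. For i = 1, 2, let zi ∈ Xi be nonzero and let qi ∈ Vi be such that zi, qi, and qi + zi are nonzero and pairwise non-proportional, with border Xi-rank of qi at most ri and border Xi-rank of qi + zi at most ri. Set pi = qi + 2·zi. Then the border (X1 × X2)-rank of p1 ⊗ p2 is at most r1·r2 + r1 + r2, which is strictly less than (r1 + 1)(r2 + 1). -/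
open scoped TensorProduct

noncomputable section

/-- The canonical (Euclidean) topology of a finite-dimensional complex vector space,
realized as the initial topology induced by all linear functionals. -/
def euclTop (V : Type*) [AddCommGroup V] [Module ℂ V] : TopologicalSpace V :=
  ⨅ f : V →ₗ[ℂ] ℂ, TopologicalSpace.induced (f : V → ℂ) inferInstance

/-- The border `X`-rank of `p`. -/
def borderRank {V : Type*} [AddCommGroup V] [Module ℂ V] (X : Set V) (p : V) : ℕ :=
  sInf {r | p ∈ @closure V (euclTop V) {q | HasRankLE X q r}}

theorem HasRankLE.add {V : Type*} [AddCommGroup V] [Module ℂ V] {X : Set V} {p q : V} {r s : ℕ}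
    (hp : HasRankLE X p r) (hq : HasRankLE X q s) : HasRankLE X (p + q) (r + s) := by
  obtain ⟨v, hv, hp⟩ := hp
  obtain ⟨w, hw, hq⟩ := hq
  refine ⟨Fin.append v w, fun i => ?_, ?_⟩
  · refine Fin.addCases (fun j => ?_) (fun j => ?_) i
    · simpa using hv j
    · simpa using hw j
  · refine Submodule.add_mem _ (Submodule.span_mono ?_ hp) (Submodule.span_mono ?_ hq)
    · rintro _ ⟨j, rfl⟩
      exact ⟨Fin.castAdd s j, by simp⟩
    · rintro _ ⟨j, rfl⟩
      exact ⟨Fin.natAdd r j, by simp⟩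

theorem HasRankLE.smul {V : Type*} [AddCommGroup V] [Module ℂ V] {X : Set V} {p : V} {r : ℕ}
    (c : ℂ) (hp : HasRankLE X p r) : HasRankLE X (c • p) r := by
  obtain ⟨v, hv, hp⟩ := hp
  exact ⟨v, hv, Submodule.smul_mem _ c hp⟩

theorem hasRankLE_one_of_mem {V : Type*} [AddCommGroup V] [Module ℂ V] {X : Set V} {x : V}
    (hx : x ∈ X) : HasRankLE X x 1 :=
  ⟨fun _ => x, fun _ => hx, Submodule.subset_span ⟨0, rfl⟩⟩

theorem HasRankLE.tmul {V1 V2 : Type*} [AddCommGroup V1] [Module ℂ V1] [AddCommGroup V2]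
    [Module ℂ V2] {X1 : Set V1} {X2 : Set V2} {p : V1} {q : V2} {r s : ℕ}
    (hp : HasRankLE X1 p r) (hq : HasRankLE X2 q s) :
    HasRankLE (segre X1 X2) (p ⊗ₜ[ℂ] q) (r * s) := by
  obtain ⟨v, hv, hp⟩ := hp
  obtain ⟨w, hw, hq⟩ := hq
  refine ⟨fun k => v (finProdFinEquiv.symm k).1 ⊗ₜ[ℂ] w (finProdFinEquiv.symm k).2,
    fun k => ⟨_, hv _, _, hw _, rfl⟩, ?_⟩
  have h := Submodule.apply_mem_map₂ (TensorProduct.mk ℂ V1 V2) hp hq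
  rw [Submodule.map₂_span_span] at h
  refine Submodule.span_mono ?_ h
  rintro _ ⟨_, ⟨i, rfl⟩, _, ⟨j, rfl⟩, rfl⟩
  exact ⟨finProdFinEquiv (i, j), by simp⟩

theorem continuous_euclTop_linear_add_const {V W : Type*} [AddCommGroup V] [Module ℂ V]
    [AddCommGroup W] [Module ℂ W] (L : V →ₗ[ℂ] W) (k : W) :
    @Continuous V W (euclTop V) (euclTop W) (fun x => L x + k) := by
  let : TopologicalSpace V := euclTop V
  refine continuous_iInf_rng.2 fun g => continuous_induced_rng.2 ?_
  have hg : Continuous (g ∘ₗ L : V →ₗ[ℂ] ℂ) :=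
    continuous_iInf_dom (i := g ∘ₗ L) continuous_induced_dom
  have hsum : Continuous fun x => g (L x) + g k := hg.add continuous_const
  simpa only [Function.comp_def, map_add] using hsum

/-- If the image of `A` under an affine map lies in the closure of `S`, then so does the image
of the closure of `A`. -/
theorem linear_add_const_mem_closure {V W : Type*} [AddCommGroup V] [Module ℂ V]
    [AddCommGroup W] [Module ℂ W] (L : V →ₗ[ℂ] W) (k : W) {A : Set V} {S : Set W}
    (h : ∀ a ∈ A, L a + k ∈ @closure W (euclTop W) S) {x : V}
    (hx : x ∈ @closure V (euclTop V) A) : L x + k ∈ @closure W (euclTop W) S := by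
  let : TopologicalSpace V := euclTop V
  let : TopologicalSpace W := euclTop W
  exact closure_minimal (t := (fun x => L x + k) ⁻¹' closure S) h
    (isClosed_closure.preimage (continuous_euclTop_linear_add_const L k)) hx

theorem stmt11 {V1 V2 : Type*}
    [AddCommGroup V1] [Module ℂ V1] [FiniteDimensional ℂ V1]
    [AddCommGroup V2] [Module ℂ V2] [FiniteDimensional ℂ V2]
    (X1 : Set V1) (X2 : Set V2) (hX1 : X1.Nonempty) (hX2 : X2.Nonempty)
    (hs1 : ∀ (c : ℂ), c ≠ 0 → ∀ x ∈ X1, c • x ∈ X1)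
    (hs2 : ∀ (c : ℂ), c ≠ 0 → ∀ x ∈ X2, c • x ∈ X2)
    (z1 : V1) (z2 : V2) (hz1X : z1 ∈ X1) (hz2X : z2 ∈ X2)
    (q1 : V1) (q2 : V2) (r1 r2 : ℕ)
    (hz10 : z1 ≠ 0) (hq10 : q1 ≠ 0) (hqz10 : q1 + z1 ≠ 0)
    (hz20 : z2 ≠ 0) (hq20 : q2 ≠ 0) (hqz20 : q2 + z2 ≠ 0)
    (h1a : ∀ c : ℂ, z1 ≠ c • q1) (h1b : ∀ c : ℂ, z1 ≠ c • (q1 + z1))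
    (h1c : ∀ c : ℂ, q1 ≠ c • (q1 + z1))
    (h2a : ∀ c : ℂ, z2 ≠ c • q2) (h2b : ∀ c : ℂ, z2 ≠ c • (q2 + z2))
    (h2c : ∀ c : ℂ, q2 ≠ c • (q2 + z2))
    (hbq1 : q1 ∈ @closure V1 (euclTop V1) {q | HasRankLE X1 q r1})
    (hbqz1 : q1 + z1 ∈ @closure V1 (euclTop V1) {q | HasRankLE X1 q r1})
    (hbq2 : q2 ∈ @closure V2 (euclTop V2) {q | HasRankLE X2 q r2})
    (hbqz2 : q2 + z2 ∈ @closure V2 (euclTop V2) {q | HasRankLE X2 q r2}) :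
    ((q1 + (2 : ℂ) • z1) ⊗ₜ[ℂ] (q2 + (2 : ℂ) • z2) ∈
        @closure (V1 ⊗[ℂ] V2) (euclTop (V1 ⊗[ℂ] V2))
          {t | HasRankLE (segre X1 X2) t (r1 * r2 + r1 + r2)}) ∧
    borderRank (segre X1 X2) ((q1 + (2 : ℂ) • z1) ⊗ₜ[ℂ] (q2 + (2 : ℂ) • z2)) ≤
        r1 * r2 + r1 + r2 ∧
    r1 * r2 + r1 + r2 < (r1 + 1) * (r2 + 1) := by
  have key : (q1 + (2 : ℂ) • z1) ⊗ₜ[ℂ] (q2 + (2 : ℂ) • z2) ∈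
      @closure (V1 ⊗[ℂ] V2) (euclTop (V1 ⊗[ℂ] V2))
        {t | HasRankLE (segre X1 X2) t (r1 * r2 + r1 + r2)} := by
    have decomposition : (q1 + (2 : ℂ) • z1) ⊗ₜ[ℂ] (q2 + (2 : ℂ) • z2) =
        q1 ⊗ₜ[ℂ] q2 + ((2 : ℂ) • ((q1 + z1) ⊗ₜ[ℂ] z2) + (2 : ℂ) • (z1 ⊗ₜ[ℂ] (q2 + z2))) := by
      simp only [TensorProduct.add_tmul, TensorProduct.tmul_add, ← TensorProduct.smul_tmul',
        TensorProduct.tmul_smul]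
      module
    rw [decomposition]
    refine linear_add_const_mem_closure ((TensorProduct.mk ℂ V1 V2).flip q2) _
      (fun a ha => ?_) hbq1
    refine linear_add_const_mem_closure (TensorProduct.mk ℂ V1 V2 a) _ (fun b hb => ?_) hbq2
    rw [add_left_comm]
    refine linear_add_const_mem_closure ((2 : ℂ) • (TensorProduct.mk ℂ V1 V2).flip z2) _
      (fun d hd => ?_) hbqz1
    rw [← add_assoc, add_comm (_ + _) ((2 : ℂ) • (z1 ⊗ₜ[ℂ] (q2 + z2)))]
    refine linear_add_const_mem_closure ((2 : ℂ) • TensorProduct.mk ℂ V1 V2 z1) _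
      (fun c hc => ?_) hbqz2
    apply @subset_closure _ (euclTop (V1 ⊗[ℂ] V2))
    have h := ((HasRankLE.tmul ha hb).add
      ((HasRankLE.tmul hd (hasRankLE_one_of_mem hz2X)).smul 2)).add
      ((HasRankLE.tmul (hasRankLE_one_of_mem hz1X) hc).smul 2)
    rw [mul_one, one_mul] at h
    rw [Set.mem_ofPred_eq]
    convert h using 1
    simp only [LinearMap.smul_apply, LinearMap.flip_apply, TensorProduct.mk_apply]
    abel
  exact ⟨key, Nat.sInf_le key, by linarith⟩
end
end
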